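/- Let (u,v) be a smooth solution of the Pavlov–Mikhalev system on ℝ³ and let ϑ : ℝ → ℝ be an arbitrary smooth function of t, with derivatives ϑ_t, ϑ_tt, ϑ_ttt. Then the pair (φ^u, φ^v) with φ^u = 0 and φ^v = (2·u_x³ + 3·u_x·u_y + u_t)·ϑ(t) + ((3/2)·y·u_x² + x·u_x + y·u_y + (1/2)·u)·ϑ_t(t) + (1/2)·y·(y·u_x + x)·ϑ_tt(t) + (1/12)·y³·ϑ_ttt(t) satisfies the linearized system, i.e., it is a symmetry generating function (the symmetry φ₁₈[ϑ]). -/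

import Mathlib

noncomputable section

/-- Partial derivative with respect to the first coordinate `t`. -/
def Dt (f : ℝ → ℝ → ℝ → ℝ) : ℝ → ℝ → ℝ → ℝ := fun t x y => deriv (fun s => f s x y) t

/-- Partial derivative with respect to the second coordinate `x`. -/
def Dx (f : ℝ → ℝ → ℝ → ℝ) : ℝ → ℝ → ℝ → ℝ := fun t x y => deriv (fun s => f t s y) x

/-- Partial derivative with respect to the third coordinate `y`. -/
def Dy (f : ℝ → ℝ → ℝ → ℝ) : ℝ → ℝ → ℝ → ℝ := fun t x y => deriv (fun s => f t x s) y

/-- `f` is a smooth function on `ℝ³` (given in curried form, coordinates `(t, x, y)`). -/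
def Smooth3 (f : ℝ → ℝ → ℝ → ℝ) : Prop :=
  ContDiff ℝ (⊤ : ℕ∞) (fun p : ℝ × ℝ × ℝ => f p.1 p.2.1 p.2.2)

/-- The Pavlov–Mikhalev equation `u_yy = u_xt − u_x·u_xy + u_y·u_xx`. -/
def PMu (u : ℝ → ℝ → ℝ → ℝ) : Prop :=
  ∀ t x y : ℝ, Dy (Dy u) t x y =
    Dt (Dx u) t x y - Dx u t x y * Dy (Dx u) t x y + Dy u t x y * Dx (Dx u) t x y

/-- The second equation of the two-component Pavlov–Mikhalev system:
`v_yy = v_xt − u_x·v_xy − 2·v_y·u_xx + 2·v_x·u_xy + u_y·v_xx`. -/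
def PMv (u v : ℝ → ℝ → ℝ → ℝ) : Prop :=
  ∀ t x y : ℝ, Dy (Dy v) t x y =
    Dt (Dx v) t x y - Dx u t x y * Dy (Dx v) t x y
      - 2 * Dy v t x y * Dx (Dx u) t x y + 2 * Dx v t x y * Dy (Dx u) t x y
      + Dy u t x y * Dx (Dx v) t x y

/-- First equation of the linearized system applied to `A = φ^u`:
`φ^u_yy = φ^u_xt + u_xx·φ^u_y + u_y·φ^u_xx − u_x·φ^u_xy − u_xy·φ^u_x`. -/
def LinU (u A : ℝ → ℝ → ℝ → ℝ) : Prop :=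
  ∀ t x y : ℝ, Dy (Dy A) t x y =
    Dt (Dx A) t x y + Dx (Dx u) t x y * Dy A t x y + Dy u t x y * Dx (Dx A) t x y
      - Dx u t x y * Dy (Dx A) t x y - Dy (Dx u) t x y * Dx A t x y

/-- Second equation of the linearized system applied to `(A, B) = (φ^u, φ^v)`. -/
def LinV (u v A B : ℝ → ℝ → ℝ → ℝ) : Prop :=
  ∀ t x y : ℝ, Dy (Dy B) t x y =
    2 * Dx v t x y * Dy (Dx A) t x y - Dy (Dx v) t x y * Dx A t x y
      + Dx (Dx v) t x y * Dy A t x y - 2 * Dy v t x y * Dx (Dx A) t x y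
      + Dt (Dx B) t x y + 2 * Dy (Dx u) t x y * Dx B t x y
      - 2 * Dx (Dx u) t x y * Dy B t x y + Dy u t x y * Dx (Dx B) t x y
      - Dx u t x y * Dy (Dx B) t x y

/-- `(A,B)` is a symmetry generating function of the Pavlov–Mikhalev system over `(u,v)`. -/
def IsSymmetry (u v A B : ℝ → ℝ → ℝ → ℝ) : Prop := LinU u A ∧ LinV u v A B

/-- First equation of the tangent system over a solution `(u,v)`:
`p_yy = u_y·p_xx − u_xy·p_x − u_x·p_xy + u_xx·p_y + p_xt`. -/
def TanP (u p : ℝ → ℝ → ℝ → ℝ) : Prop :=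
  ∀ t x y : ℝ, Dy (Dy p) t x y =
    Dy u t x y * Dx (Dx p) t x y - Dy (Dx u) t x y * Dx p t x y
      - Dx u t x y * Dy (Dx p) t x y + Dx (Dx u) t x y * Dy p t x y + Dt (Dx p) t x y

/-- Second equation of the tangent system over a solution `(u,v)`:
`q_yy = 2·v_x·p_xy + v_xx·p_y − v_xy·p_x − 2·v_y·p_xx + 2·u_xy·q_x + u_y·q_xx
  − u_x·q_xy − 2·u_xx·q_y + q_xt`. -/
def TanQ (u v p q : ℝ → ℝ → ℝ → ℝ) : Prop :=
  ∀ t x y : ℝ, Dy (Dy q) t x y =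
    2 * Dx v t x y * Dy (Dx p) t x y + Dx (Dx v) t x y * Dy p t x y
      - Dy (Dx v) t x y * Dx p t x y - 2 * Dy v t x y * Dx (Dx p) t x y
      + 2 * Dy (Dx u) t x y * Dx q t x y + Dy u t x y * Dx (Dx q) t x y
      - Dx u t x y * Dy (Dx q) t x y - 2 * Dx (Dx u) t x y * Dy q t x y
      + Dt (Dx q) t x y


/-- A curried function, viewed on the product `ℝ × ℝ × ℝ`. -/
def onProd (f : ℝ → ℝ → ℝ → ℝ) : ℝ × ℝ × ℝ → ℝ := fun p => f p.1 p.2.1 p.2.2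

/-- The constant function on `ℝ³`. -/
def constFun (c : ℝ) : ℝ → ℝ → ℝ → ℝ := fun _ _ _ => c

/-- A function of `t` alone, viewed as a function on `ℝ³`. -/
def ofT (g : ℝ → ℝ) : ℝ → ℝ → ℝ → ℝ := fun t _ _ => g t

/-- The coordinate function `x`. -/
def coordX : ℝ → ℝ → ℝ → ℝ := fun _ x _ => x

/-- The coordinate function `y`. -/
def coordY : ℝ → ℝ → ℝ → ℝ := fun _ _ y => y

namespace Smooth3

variable {f g : ℝ → ℝ → ℝ → ℝ}

theorem add (hf : Smooth3 f) (hg : Smooth3 g) : Smooth3 (f + g) := ContDiff.add hf hg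

theorem sub (hf : Smooth3 f) (hg : Smooth3 g) : Smooth3 (f - g) := ContDiff.sub hf hg

theorem mul (hf : Smooth3 f) (hg : Smooth3 g) : Smooth3 (f * g) := ContDiff.mul hf hg

theorem constFun (c : ℝ) : Smooth3 (constFun c) := contDiff_const

theorem coordX : Smooth3 coordX := contDiff_fst.comp contDiff_snd

theorem coordY : Smooth3 coordY := contDiff_snd.comp contDiff_snd

theorem ofT {θ : ℝ → ℝ} (hθ : ContDiff ℝ (⊤ : ℕ∞) θ) : Smooth3 (ofT θ) :=
  hθ.comp contDiff_fst

theorem hasFDerivAt (hf : Smooth3 f) (p : ℝ × ℝ × ℝ) :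
    HasFDerivAt (onProd f) (fderiv ℝ (onProd f) p) p :=
  (ContDiff.differentiable hf (by simp) p).hasFDerivAt

theorem hasDerivAt_t (hf : Smooth3 f) (t x y : ℝ) :
    HasDerivAt (fun s => f s x y) (fderiv ℝ (onProd f) (t, x, y) (1, 0, 0)) t :=
  HasFDerivAt.comp_hasDerivAt (l := onProd f) t (hf.hasFDerivAt (t, x, y))
    ((hasDerivAt_id t).prodMk (hasDerivAt_const t (x, y)))

theorem hasDerivAt_x (hf : Smooth3 f) (t x y : ℝ) :
    HasDerivAt (fun s => f t s y) (fderiv ℝ (onProd f) (t, x, y) (0, 1, 0)) x :=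
  HasFDerivAt.comp_hasDerivAt (l := onProd f) x (hf.hasFDerivAt (t, x, y))
    ((hasDerivAt_const x t).prodMk ((hasDerivAt_id x).prodMk (hasDerivAt_const x y)))

theorem hasDerivAt_y (hf : Smooth3 f) (t x y : ℝ) :
    HasDerivAt (fun s => f t x s) (fderiv ℝ (onProd f) (t, x, y) (0, 0, 1)) y :=
  HasFDerivAt.comp_hasDerivAt (l := onProd f) y (hf.hasFDerivAt (t, x, y))
    ((hasDerivAt_const y t).prodMk ((hasDerivAt_const y x).prodMk (hasDerivAt_id y)))

theorem onProd_Dt (hf : Smooth3 f) :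
    onProd (Dt f) = fun p => fderiv ℝ (onProd f) p (1, 0, 0) :=
  funext fun p => (hf.hasDerivAt_t p.1 p.2.1 p.2.2).deriv

theorem onProd_Dx (hf : Smooth3 f) :
    onProd (Dx f) = fun p => fderiv ℝ (onProd f) p (0, 1, 0) :=
  funext fun p => (hf.hasDerivAt_x p.1 p.2.1 p.2.2).deriv

theorem onProd_Dy (hf : Smooth3 f) :
    onProd (Dy f) = fun p => fderiv ℝ (onProd f) p (0, 0, 1) :=
  funext fun p => (hf.hasDerivAt_y p.1 p.2.1 p.2.2).deriv

theorem contDiff_fderiv (hf : Smooth3 f) :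
    ContDiff ℝ (⊤ : ℕ∞) (fderiv ℝ (onProd f)) :=
  ContDiff.fderiv_right (n := (⊤ : ℕ∞)) hf (by simp)

theorem contDiff_fderiv_apply (hf : Smooth3 f) (w : ℝ × ℝ × ℝ) :
    ContDiff ℝ (⊤ : ℕ∞) fun p => fderiv ℝ (onProd f) p w :=
  hf.contDiff_fderiv.clm_apply contDiff_const

theorem Dt (hf : Smooth3 f) : Smooth3 (Dt f) := by
  change ContDiff ℝ (⊤ : ℕ∞) (onProd (_root_.Dt f))
  rw [hf.onProd_Dt]
  exact hf.contDiff_fderiv_apply _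

theorem Dx (hf : Smooth3 f) : Smooth3 (Dx f) := by
  change ContDiff ℝ (⊤ : ℕ∞) (onProd (_root_.Dx f))
  rw [hf.onProd_Dx]
  exact hf.contDiff_fderiv_apply _

theorem Dy (hf : Smooth3 f) : Smooth3 (Dy f) := by
  change ContDiff ℝ (⊤ : ℕ∞) (onProd (_root_.Dy f))
  rw [hf.onProd_Dy]
  exact hf.contDiff_fderiv_apply _

/-- Symmetry of the second derivative, for arbitrary directions. -/
theorem fderiv_fderiv_comm (hf : Smooth3 f) (p w w' : ℝ × ℝ × ℝ) :
    fderiv ℝ (fun q => fderiv ℝ (onProd f) q w) p w' =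
      fderiv ℝ (fun q => fderiv ℝ (onProd f) q w') p w := by
  have hd : DifferentiableAt ℝ (fderiv ℝ (onProd f)) p :=
    hf.contDiff_fderiv.differentiable (by simp) p
  have key : ∀ a b : ℝ × ℝ × ℝ, fderiv ℝ (fun q => fderiv ℝ (onProd f) q a) p b =
      fderiv ℝ (fderiv ℝ (onProd f)) p b a := by
    intro a b
    rw [fderiv_clm_apply hd (differentiableAt_const a)]
    simp
  have hs : IsSymmSndFDerivAt ℝ (onProd f) p :=
    ContDiffAt.isSymmSndFDerivAt (n := (⊤ : ℕ∞)) (ContDiff.contDiffAt hf)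
      (by simp only [minSmoothness_of_isRCLikeNormedField]; exact WithTop.coe_le_coe.2 le_top)
  rw [key, key, hs w' w]

theorem Dx_Dy (hf : Smooth3 f) : _root_.Dx (_root_.Dy f) = _root_.Dy (_root_.Dx f) := by
  funext t x y
  rw [show _root_.Dx (_root_.Dy f) t x y = _ from (hf.Dy.hasDerivAt_x t x y).deriv,
    show _root_.Dy (_root_.Dx f) t x y = _ from (hf.Dx.hasDerivAt_y t x y).deriv,
    hf.onProd_Dy, hf.onProd_Dx, hf.fderiv_fderiv_comm]

theorem Dx_Dt (hf : Smooth3 f) : _root_.Dx (_root_.Dt f) = _root_.Dt (_root_.Dx f) := by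
  funext t x y
  rw [show _root_.Dx (_root_.Dt f) t x y = _ from (hf.Dt.hasDerivAt_x t x y).deriv,
    show _root_.Dt (_root_.Dx f) t x y = _ from (hf.Dx.hasDerivAt_t t x y).deriv,
    hf.onProd_Dt, hf.onProd_Dx, hf.fderiv_fderiv_comm]

theorem Dy_Dt (hf : Smooth3 f) : _root_.Dy (_root_.Dt f) = _root_.Dt (_root_.Dy f) := by
  funext t x y
  rw [show _root_.Dy (_root_.Dt f) t x y = _ from (hf.Dt.hasDerivAt_y t x y).deriv,
    show _root_.Dt (_root_.Dy f) t x y = _ from (hf.Dy.hasDerivAt_t t x y).deriv,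
    hf.onProd_Dt, hf.onProd_Dy, hf.fderiv_fderiv_comm]

theorem Dt_add (hf : Smooth3 f) (hg : Smooth3 g) :
    _root_.Dt (f + g) = _root_.Dt f + _root_.Dt g :=
  funext fun t => funext fun x => funext fun y =>
    deriv_add (hf.hasDerivAt_t t x y).differentiableAt
      (hg.hasDerivAt_t t x y).differentiableAt

theorem Dt_sub (hf : Smooth3 f) (hg : Smooth3 g) :
    _root_.Dt (f - g) = _root_.Dt f - _root_.Dt g :=
  funext fun t => funext fun x => funext fun y =>
    deriv_sub (hf.hasDerivAt_t t x y).differentiableAt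
      (hg.hasDerivAt_t t x y).differentiableAt

theorem Dt_mul (hf : Smooth3 f) (hg : Smooth3 g) :
    _root_.Dt (f * g) = _root_.Dt f * g + f * _root_.Dt g :=
  funext fun t => funext fun x => funext fun y =>
    deriv_mul (hf.hasDerivAt_t t x y).differentiableAt
      (hg.hasDerivAt_t t x y).differentiableAt

theorem Dx_add (hf : Smooth3 f) (hg : Smooth3 g) :
    _root_.Dx (f + g) = _root_.Dx f + _root_.Dx g :=
  funext fun t => funext fun x => funext fun y =>
    deriv_add (hf.hasDerivAt_x t x y).differentiableAt
      (hg.hasDerivAt_x t x y).differentiableAt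

theorem Dx_sub (hf : Smooth3 f) (hg : Smooth3 g) :
    _root_.Dx (f - g) = _root_.Dx f - _root_.Dx g :=
  funext fun t => funext fun x => funext fun y =>
    deriv_sub (hf.hasDerivAt_x t x y).differentiableAt
      (hg.hasDerivAt_x t x y).differentiableAt

theorem Dx_mul (hf : Smooth3 f) (hg : Smooth3 g) :
    _root_.Dx (f * g) = _root_.Dx f * g + f * _root_.Dx g :=
  funext fun t => funext fun x => funext fun y =>
    deriv_mul (hf.hasDerivAt_x t x y).differentiableAt
      (hg.hasDerivAt_x t x y).differentiableAt

theorem Dy_add (hf : Smooth3 f) (hg : Smooth3 g) :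
    _root_.Dy (f + g) = _root_.Dy f + _root_.Dy g :=
  funext fun t => funext fun x => funext fun y =>
    deriv_add (hf.hasDerivAt_y t x y).differentiableAt
      (hg.hasDerivAt_y t x y).differentiableAt

theorem Dy_sub (hf : Smooth3 f) (hg : Smooth3 g) :
    _root_.Dy (f - g) = _root_.Dy f - _root_.Dy g :=
  funext fun t => funext fun x => funext fun y =>
    deriv_sub (hf.hasDerivAt_y t x y).differentiableAt
      (hg.hasDerivAt_y t x y).differentiableAt

theorem Dy_mul (hf : Smooth3 f) (hg : Smooth3 g) :
    _root_.Dy (f * g) = _root_.Dy f * g + f * _root_.Dy g :=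
  funext fun t => funext fun x => funext fun y =>
    deriv_mul (hf.hasDerivAt_y t x y).differentiableAt
      (hg.hasDerivAt_y t x y).differentiableAt

end Smooth3

theorem Dt_constFun (c : ℝ) : Dt (constFun c) = constFun 0 := by
  funext t x y
  simp [Dt, constFun]

theorem Dx_constFun (c : ℝ) : Dx (constFun c) = constFun 0 := by
  funext t x y
  simp [Dx, constFun]

theorem Dy_constFun (c : ℝ) : Dy (constFun c) = constFun 0 := by
  funext t x y
  simp [Dy, constFun]

theorem Dt_coordX : Dt coordX = constFun 0 := by
  funext t x y
  simp [Dt, coordX, constFun]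

theorem Dx_coordX : Dx coordX = constFun 1 := by
  funext t x y
  simp [Dx, coordX, constFun]

theorem Dy_coordX : Dy coordX = constFun 0 := by
  funext t x y
  simp [Dy, coordX, constFun]

theorem Dt_coordY : Dt coordY = constFun 0 := by
  funext t x y
  simp [Dt, coordY, constFun]

theorem Dx_coordY : Dx coordY = constFun 0 := by
  funext t x y
  simp [Dx, coordY, constFun]

theorem Dy_coordY : Dy coordY = constFun 1 := by
  funext t x y
  simp [Dy, coordY, constFun]

theorem Dt_ofT (θ : ℝ → ℝ) : Dt (ofT θ) = ofT (deriv θ) := rfl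

theorem Dx_ofT (θ : ℝ → ℝ) : Dx (ofT θ) = constFun 0 := by
  funext t x y
  simp [Dx, ofT, constFun]

theorem Dy_ofT (θ : ℝ → ℝ) : Dy (ofT θ) = constFun 0 := by
  funext t x y
  simp [Dy, ofT, constFun]

theorem ContDiff.deriv_smooth {θ : ℝ → ℝ} (hθ : ContDiff ℝ (⊤ : ℕ∞) θ) :
    ContDiff ℝ (⊤ : ℕ∞) (deriv θ) :=
  (contDiff_infty_iff_deriv.1 hθ).2

theorem isSymmetry_zero {u v B : ℝ → ℝ → ℝ → ℝ}
    (hB : Dy (Dy B) = Dt (Dx B) + constFun 2 * Dy (Dx u) * Dx B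
      - constFun 2 * Dx (Dx u) * Dy B + Dy u * Dx (Dx B) - Dx u * Dy (Dx B)) :
    IsSymmetry u v (fun _ _ _ => 0) B := by
  have hx : Dx (fun _ _ _ => (0 : ℝ)) = fun _ _ _ => 0 := Dx_constFun 0
  have hy : Dy (fun _ _ _ => (0 : ℝ)) = fun _ _ _ => 0 := Dy_constFun 0
  have ht : Dt (fun _ _ _ => (0 : ℝ)) = fun _ _ _ => 0 := Dt_constFun 0
  refine ⟨fun t x y => ?_, fun t x y => ?_⟩
  · simp only [hx, hy, ht]
    ring
  · simp only [hx, hy, hB, Pi.add_apply, Pi.sub_apply, Pi.mul_apply, constFun]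
    ring

theorem phi18_is_symmetry (u v : ℝ → ℝ → ℝ → ℝ) (hu : Smooth3 u) (hv : Smooth3 v)
    (hPMu : PMu u) (hPMv : PMv u v)
    (ϑ : ℝ → ℝ) (hϑ : ContDiff ℝ (⊤ : ℕ∞) ϑ) :
    IsSymmetry u v
      (fun _t _x _y => (0 : ℝ))
      (fun t x y => (2 * (Dx u t x y)^3 + 3 * Dx u t x y * Dy u t x y + Dt u t x y) * ϑ t
        + ((3/2) * y * (Dx u t x y)^2 + x * Dx u t x y + y * Dy u t x y + (1/2) * u t x y) * deriv ϑ t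
        + (1/2) * y * (y * Dx u t x y + x) * deriv (deriv ϑ) t
        + (1/12) * y^3 * deriv (deriv (deriv ϑ)) t) := by
  have hE : Dy (Dy u) = Dt (Dx u) - Dx u * Dy (Dx u) + Dy u * Dx (Dx u) := by
    funext t x y
    exact hPMu t x y
  have hEx : Dy (Dy (Dx u)) =
      Dt (Dx (Dx u)) - Dx u * Dy (Dx (Dx u)) + Dy u * Dx (Dx (Dx u)) := by
    have h := congrArg Dx hE
    rw [hu.Dy.Dx_Dy, hu.Dx_Dy] at h
    rw [h]
    simp (maxDischargeDepth := 20) only [Smooth3.Dx_add, Smooth3.Dx_sub, Smooth3.Dx_mul, Smooth3.Dx_Dy, Smooth3.Dx_Dt,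
      Smooth3.sub, Smooth3.mul, Smooth3.Dx, Smooth3.Dy, Smooth3.Dt, hu]
    ring
  have hθ₁ := hϑ.deriv_smooth
  have hθ₂ := hθ₁.deriv_smooth
  have hθ₃ := hθ₂.deriv_smooth
  apply isSymmetry_zero
  have hB : (fun t x y => (2 * (Dx u t x y)^3 + 3 * Dx u t x y * Dy u t x y + Dt u t x y) * ϑ t
        + ((3/2) * y * (Dx u t x y)^2 + x * Dx u t x y + y * Dy u t x y + (1/2) * u t x y) * deriv ϑ t
        + (1/2) * y * (y * Dx u t x y + x) * deriv (deriv ϑ) t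
        + (1/12) * y^3 * deriv (deriv (deriv ϑ)) t) =
      (constFun 2 * (Dx u * Dx u * Dx u) + constFun 3 * Dx u * Dy u + Dt u) * ofT ϑ
        + (constFun (3/2) * coordY * (Dx u * Dx u) + coordX * Dx u + coordY * Dy u
          + constFun (1/2) * u) * ofT (deriv ϑ)
        + constFun (1/2) * coordY * (coordY * Dx u + coordX) * ofT (deriv (deriv ϑ))
        + constFun (1/12) * (coordY * coordY * coordY) * ofT (deriv (deriv (deriv ϑ))) := by
    funext t x y
    simp only [Pi.add_apply, Pi.mul_apply, constFun, ofT, coordX, coordY]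
    ring
  rw [hB]
  simp (maxDischargeDepth := 20) only [Smooth3.Dx_add, Smooth3.Dx_mul, Smooth3.Dy_add, Smooth3.Dy_sub,
    Smooth3.Dy_mul, Smooth3.Dt_add, Smooth3.Dt_sub, Smooth3.Dt_mul, Smooth3.Dx_Dy, Smooth3.Dx_Dt,
    Smooth3.Dy_Dt, Smooth3.add, Smooth3.sub, Smooth3.mul, Smooth3.Dx, Smooth3.Dy, Smooth3.Dt,
    Smooth3.constFun, Smooth3.coordX, Smooth3.coordY, Smooth3.ofT, Dt_constFun, Dx_constFun,
    Dy_constFun, Dt_coordX, Dx_coordX, Dy_coordX, Dt_coordY, Dx_coordY, Dy_coordY, Dt_ofT, Dx_ofT,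
    Dy_ofT, hE, hEx, hu, hϑ, hθ₁, hθ₂, hθ₃]
  funext t x y
  simp only [Pi.add_apply, Pi.sub_apply, Pi.mul_apply, constFun, ofT, coordX, coordY]
  ring
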